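/- For every solution P = (E_P, λ_P) of the instance (T, 6k−1, 4k) and every i ∈ {1,...,3k}, the subtree L_i is the only P-component contained in T_i, and the subtree of T induced by (V(T_i) \ V(L_i)) ∪ {p_i} is a P-component with exactly s vertices. -/

import Mathlib

namespace TP

/-- Rooted binary trees. -/
inductive RBT : Type where
  | nil : RBT
  | node : RBT → RBT → RBT

/-- The number of vertices of a rooted binary tree. -/
def RBT.size : RBT → ℕ
  | .nil => 0
  | .node l r => l.size + r.size + 1

/-- A nice binary tree: it has at most one vertex, or its left and right subtrees are
nice binary trees whose numbers of vertices differ by at most 1. -/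
def RBT.IsNice : RBT → Prop
  | .nil => True
  | .node l r => l.IsNice ∧ r.IsNice ∧ Nat.dist l.size r.size ≤ 1

/-- Valid positions (vertices) of a rooted binary tree, encoded as lists of booleans:
`false` means "go to the left child", `true` means "go to the right child". -/
def RBT.Valid : RBT → List Bool → Prop
  | .nil, _ => False
  | .node _ _, [] => True
  | .node l _, (false :: bs) => RBT.Valid l bs
  | .node _ r, (true :: bs) => RBT.Valid r bs

/-- The vertex type of the tree `T` built from the path `H = (p_1, …, p_{3k})` (the `Sum.inl`
part) together with, for each `i`, the binary tree `T_i` with shape `Tsh i` (the `Sum.inr` part,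
vertices of `T_i` being its valid positions). -/
abbrev Vtx (k : ℕ) (Tsh : Fin (3*k) → RBT) : Type :=
  Fin (3*k) ⊕ (Σ i : Fin (3*k), {l : List Bool // (Tsh i).Valid l})

/-- The tree `T`: the path `p_1 — p_2 — ⋯ — p_{3k}`, an edge between `p_i` and the root `[]`
of `T_i` for each `i`, and the parent-child edges inside each binary tree `T_i`. -/
def TGraph (k : ℕ) (Tsh : Fin (3*k) → RBT) : SimpleGraph (Vtx k Tsh) :=
  SimpleGraph.fromRel (fun v w =>
    match v, w with
    | Sum.inl i, Sum.inl j => (i : ℕ) + 1 = (j : ℕ)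
    | Sum.inl i, Sum.inr ⟨j, x⟩ => i = j ∧ x.1 = []
    | Sum.inr ⟨i, x⟩, Sum.inr ⟨j, y⟩ => i = j ∧ ∃ c : Bool, y.1 = x.1 ++ [c]
    | _, _ => False)

/-- Combine the shapes of the left subtrees `L_i` and right subtrees `R_i` into
the shapes of the trees `T_i`. -/
def nodes {ι : Type} (L R : ι → RBT) : ι → RBT := fun i => RBT.node (L i) (R i)

/-- The vertex set of the subtree `T_i`. -/
def TiSet (k : ℕ) (Tsh : Fin (3*k) → RBT) (i : Fin (3*k)) : Set (Vtx k Tsh) :=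
  {v | ∃ x : {l : List Bool // (Tsh i).Valid l}, v = Sum.inr ⟨i, x⟩}

/-- The vertex set of the left subtree `L_i` of `T_i` (positions starting with `false`). -/
def LiSet (k : ℕ) (Tsh : Fin (3*k) → RBT) (i : Fin (3*k)) : Set (Vtx k Tsh) :=
  {v | ∃ x : {l : List Bool // (Tsh i).Valid l}, x.1.head? = some false ∧ v = Sum.inr ⟨i, x⟩}

/-- The vertex set of the right subtree `R_i` of `T_i` (positions starting with `true`). -/
def RiSet (k : ℕ) (Tsh : Fin (3*k) → RBT) (i : Fin (3*k)) : Set (Vtx k Tsh) :=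
  {v | ∃ x : {l : List Bool // (Tsh i).Valid l}, x.1.head? = some true ∧ v = Sum.inr ⟨i, x⟩}

/-- A solution `P = (E_P, λ_P)` cutting exactly `kk` edges: `E_P` is a set of exactly `kk`
edges of `G`, and `lam` assigns the connected components of `G − E_P` to `b` groups
(it is constant on each component), so that group `g` receives exactly `sizes g` vertices. -/
def IsSolutionEq {V : Type} (G : SimpleGraph V) (EP : Set (Sym2 V)) (kk b : ℕ)
    (sizes : Fin b → ℕ) (lam : V → Fin b) : Prop :=
  EP ⊆ G.edgeSet ∧ EP.ncard = kk ∧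
    (∀ v w : V, (G.deleteEdges EP).Reachable v w → lam v = lam w) ∧
    ∀ g : Fin b, {v | lam v = g}.ncard = sizes g

/-- `C` is a `P`-component: a connected component of `G − E_P`. -/
def IsPComp {V : Type} (G : SimpleGraph V) (EP : Set (Sym2 V)) (C : Set V) : Prop :=
  ∃ v : V, C = {w | (G.deleteEdges EP).Reachable v w}

end TP

open TP

namespace TP

section absTree
open Classical

variable {V : Type} (G : SimpleGraph V) (par : V → V) (dep : V → ℕ) (root : V)

/-- the set of cut tops -/
def cutSet {V : Type} (par : V → V) (root : V) (EP : Set (Sym2 V)) : Set V :=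
  {v | v ≠ root ∧ s(v, par v) ∈ EP}

theorem abs_card (hadj : ∀ v w, G.Adj v w ↔ (v ≠ root ∧ w = par v) ∨ (w ≠ root ∧ v = par w))
    (hdep : ∀ v, v ≠ root → dep (par v) < dep v) (EP : Set (Sym2 V)) (hEP : EP ⊆ G.edgeSet) :
    (cutSet par root EP).ncard = EP.ncard := by
  refine Set.ncard_congr (fun v _ => s(v, par v)) ?_ ?_ ?_
  · intro v hv; exact hv.2
  · intro v w hv hw h
    rw [Sym2.eq_iff] at h
    rcases h with h | h
    · exact h.1
    · have h1 := hdep v hv.1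
      have h2 := hdep w hw.1
      rw [h.2] at h1
      rw [← h.1] at h2
      omega
  · intro e he
    induction e using Sym2.ind with
    | _ v w =>
      have h := hEP he
      rw [SimpleGraph.mem_edgeSet, hadj] at h
      rcases h with ⟨h1, h2⟩ | ⟨h1, h2⟩
      · subst h2; exact ⟨v, ⟨h1, he⟩, rfl⟩
      · subst h2
        rw [Sym2.eq_swap] at he
        exact ⟨w, ⟨h1, he⟩, Sym2.eq_swap⟩

theorem abs_top (hadj : ∀ v w, G.Adj v w ↔ (v ≠ root ∧ w = par v) ∨ (w ≠ root ∧ v = par w))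
    (hdep : ∀ v, v ≠ root → dep (par v) < dep v) (EP : Set (Sym2 V)) :
    ∃ top : V → V, (∀ v, v = root ∨ v ∈ cutSet par root EP → top v = v) ∧
      (∀ v, ¬ (v = root ∨ v ∈ cutSet par root EP) → top v = top (par v)) ∧
      (∀ v w, (G.deleteEdges EP).Reachable v w ↔ top v = top w) := by
  have hex : ∀ n, ∀ v, dep v ≤ n → ∃ m, par^[m] v = root ∨ par^[m] v ∈ cutSet par root EP := by
    intro n
    induction n with
    | zero =>
      intro v hv
      refine ⟨0, ?_⟩
      by_contra hc
      simp only [Function.iterate_zero, id] at hc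
      push Not at hc
      have := hdep v hc.1
      omega
    | succ n ih =>
      intro v hv
      by_cases h : v = root
      · exact ⟨0, Or.inl h⟩
      · obtain ⟨m, hm⟩ := ih (par v) (by have := hdep v h; omega)
        exact ⟨m + 1, hm⟩
  have hex' : ∀ v, ∃ m, par^[m] v = root ∨ par^[m] v ∈ cutSet par root EP :=
    fun v => hex _ v le_rfl
  let top : V → V := fun v => par^[Nat.find (hex' v)] v
  have t1 : ∀ v, v = root ∨ v ∈ cutSet par root EP → top v = v := by
    intro v hv
    have : Nat.find (hex' v) = 0 := by rw [Nat.find_eq_zero]; exact hv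
    simp only [top, this]; rfl
  have t2 : ∀ v, ¬ (v = root ∨ v ∈ cutSet par root EP) → top v = top (par v) := by
    intro v hv
    have : Nat.find (hex' v) = Nat.find (hex' (par v)) + 1 :=
      Nat.find_comp_succ (hex' v) (hex' (par v)) hv
    simp only [top, this]; rfl
  refine ⟨top, t1, t2, ?_⟩
  have r1 : ∀ n, ∀ v, dep v ≤ n → (G.deleteEdges EP).Reachable v (top v) := by
    intro n
    induction n with
    | zero =>
      intro v hv
      by_cases h : v = root
      · rw [t1 v (Or.inl h)]
      · have := hdep v h; omega
    | succ n ih =>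
      intro v hv
      by_cases h : v = root ∨ v ∈ cutSet par root EP
      · rw [t1 v h]
      · rw [t2 v h]
        have hr : v ≠ root := fun h' => h (Or.inl h')
        have := hdep v hr
        refine SimpleGraph.Reachable.trans (SimpleGraph.Adj.reachable ?_) (ih (par v) (by omega))
        rw [SimpleGraph.deleteEdges_adj]
        exact ⟨(hadj _ _).2 (Or.inl ⟨hr, rfl⟩), fun h' => h (Or.inr ⟨hr, h'⟩)⟩
  have a1 : ∀ v w, (G.deleteEdges EP).Adj v w → top v = top w := by
    intro v w h
    rw [SimpleGraph.deleteEdges_adj, hadj] at h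
    obtain ⟨⟨h1, h2⟩ | ⟨h1, h2⟩, h3⟩ := h
    · subst h2
      exact t2 v (by rintro (h | h); exacts [h1 h, h3 h.2])
    · subst h2
      rw [Sym2.eq_swap] at h3
      exact (t2 w (by rintro (h | h); exacts [h1 h, h3 h.2])).symm
  intro v w
  constructor
  · rintro ⟨p⟩
    induction p with
    | nil => rfl
    | cons h _ ih => exact (a1 _ _ h).trans ih
  · intro h
    exact (r1 _ v le_rfl).trans (h ▸ (r1 _ w le_rfl).symm)

end absTree

/-! binary trees -/

def RBT.sub : RBT → List Bool → RBT
  | t, [] => t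
  | .nil, _ => .nil
  | .node l _, (false :: bs) => RBT.sub l bs
  | .node _ r, (true :: bs) => RBT.sub r bs

def RBT.pos : RBT → Finset (List Bool)
  | .nil => ∅
  | .node l r => insert [] (l.pos.image (List.cons false) ∪ r.pos.image (List.cons true))

theorem RBT.mem_pos (t : RBT) (l : List Bool) : l ∈ t.pos ↔ t.Valid l := by
  induction t generalizing l with
  | nil => simp [RBT.pos, RBT.Valid]
  | node a b iha ihb =>
    rcases l with _ | ⟨c, l⟩
    · simp [RBT.pos, RBT.Valid]
    · cases c <;> simp [RBT.pos, RBT.Valid, iha, ihb]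

theorem RBT.card_pos (t : RBT) : t.pos.card = t.size := by
  induction t with
  | nil => simp [RBT.pos, RBT.size]
  | node a b iha ihb =>
    rw [RBT.pos, Finset.card_insert_of_notMem (by simp), Finset.card_union_of_disjoint,
      Finset.card_image_of_injective _ (List.cons_injective),
      Finset.card_image_of_injective _ (List.cons_injective), iha, ihb, RBT.size]
    rw [Finset.disjoint_left]
    simp

noncomputable instance (t : RBT) : Fintype {l : List Bool // t.Valid l} :=
  Fintype.subtype t.pos (t.mem_pos)

theorem RBT.card_valid (t : RBT) : Fintype.card {l : List Bool // t.Valid l} = t.size := by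
  rw [← RBT.card_pos, Fintype.card_of_subtype t.pos t.mem_pos]

theorem RBT.valid_append (t : RBT) (l m : List Bool) : t.Valid (l ++ m) → (t.sub l).Valid m := by
  induction l generalizing t with
  | nil => simp [RBT.sub]
  | cons c l ih =>
    cases t with
    | nil => simp [RBT.Valid]
    | node a b => cases c <;> simpa [RBT.Valid, RBT.sub] using ih _

theorem RBT.valid_append' (t : RBT) (l m : List Bool) : (t.sub l).Valid m → t.Valid (l ++ m) := by
  induction l generalizing t with
  | nil => simp [RBT.sub]
  | cons c l ih =>
    cases t with
    | nil => cases c <;> simp [RBT.sub, RBT.Valid]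
    | node a b => cases c <;> simpa [RBT.Valid, RBT.sub] using ih _

theorem RBT.valid_prefix (t : RBT) {l m : List Bool} (h : l <+: m) (hm : t.Valid m) :
    t.Valid l := by
  induction l generalizing t m with
  | nil =>
    cases t with
    | nil => exact absurd hm (by simp [RBT.Valid])
    | node a b => simp [RBT.Valid]
  | cons c l ih =>
    obtain ⟨m', rfl⟩ := h
    cases t with
    | nil => exact absurd hm (by simp [RBT.Valid])
    | node a b =>
      cases c
      · exact ih a (m := l ++ m') ⟨m', rfl⟩ (by simpa [RBT.Valid] using hm)
      · exact ih b (m := l ++ m') ⟨m', rfl⟩ (by simpa [RBT.Valid] using hm)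

/-- number of valid positions extending `l` -/
theorem RBT.card_ext (t : RBT) (l : List Bool) :
    (Finset.univ.filter (fun m : {l : List Bool // t.Valid l} => l <+: m.1)).card
      = (t.sub l).size := by
  rw [← RBT.card_pos]
  symm
  refine Finset.card_bij (fun m hm => ⟨l ++ m, t.valid_append' l m ((RBT.mem_pos _ _).1 hm)⟩)
    ?_ ?_ ?_
  · intro m hm; simp
  · intro m hm m' hm' h; simpa using h
  · rintro ⟨m, hm⟩ h
    obtain ⟨m', rfl⟩ := (Finset.mem_filter.1 h).2
    exact ⟨m', (RBT.mem_pos _ _).2 (t.valid_append _ _ hm), rfl⟩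

theorem RBT.sub_size_le (t : RBT) (l : List Bool) : (t.sub l).size ≤ t.size := by
  induction l generalizing t with
  | nil => simp [RBT.sub]
  | cons c l ih =>
    cases t with
    | nil => simp [RBT.sub]
    | node a b =>
      cases c
      · have := ih a; simp only [RBT.sub, RBT.size]; omega
      · have := ih b; simp only [RBT.sub, RBT.size]; omega

theorem RBT.nice_child (t : RBT) (ht : t.IsNice) (c : Bool) (l : List Bool) :
    (t.sub (c :: l)).size ≤ t.size / 2 := by
  cases t with
  | nil => simp [RBT.sub, RBT.size]
  | node a b =>
    have h := ht.2.2
    rw [Nat.dist] at h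
    cases c
    · have := a.sub_size_le l; simp only [RBT.sub, RBT.size]; omega
    · have := b.sub_size_le l; simp only [RBT.sub, RBT.size]; omega

theorem RBT.R_child (t : RBT) (ht : t.IsNice) (s : ℕ) (hs : 4 ∣ s) (hs' : 24 < s)
    (hz : t.size = s - 2) (c : Bool) (l : List Bool) :
    (t.sub (c :: l)).size = s / 2 - 1 ∨ (t.sub (c :: l)).size = s / 2 - 2 ∨
    (t.sub (c :: l)).size ≤ s / 4 - 1 := by
  cases t with
  | nil => simp [RBT.sub, RBT.size]
  | node a b =>
    have h := ht.2.2
    rw [Nat.dist] at h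
    rw [RBT.size] at hz
    cases c
    · simp only [RBT.sub]
      cases l with
      | nil => simp only [RBT.sub]; omega
      | cons d l => have := a.nice_child ht.1 d l; omega
    · simp only [RBT.sub]
      cases l with
      | nil => simp only [RBT.sub]; omega
      | cons d l => have := b.nice_child ht.2.1 d l; omega

theorem RBT.sizes (L R : RBT) (s a k : ℕ) (hk : 1 ≤ k) (hs4 : 4 ∣ s) (hs : 24 * k < s)
    (ha : s / 4 + 6 * k ≤ a ∧ a ≤ s / 2 - 18 * k) (hL : L.IsNice ∧ L.size = a)
    (hR : R.IsNice ∧ R.size = s - 2) (l : List Bool) (hl : l ≠ []) :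
    (l = [false] ∧ ((RBT.node L R).sub l).size = a) ∨
    (l = [true] ∧ ((RBT.node L R).sub l).size = s - 2) ∨
    ((RBT.node L R).sub l).size = s / 2 - 1 ∨ ((RBT.node L R).sub l).size = s / 2 - 2 ∨
    ((RBT.node L R).sub l).size ≤ s / 4 - 1 := by
  rcases l with _ | ⟨c, l⟩
  · exact absurd rfl hl
  cases c
  · simp only [RBT.sub]
    rcases l with _ | ⟨c, l⟩
    · left; exact ⟨rfl, by simpa [RBT.sub] using hL.2⟩
    · have := L.nice_child hL.1 c l
      omega
  · simp only [RBT.sub]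
    rcases l with _ | ⟨c, l⟩
    · right; left; exact ⟨rfl, by simpa [RBT.sub] using hR.2⟩
    · have := R.R_child hR.1 s hs4 (by omega) hR.2 c l
      omega

end TP

namespace TP

/-- weight of a component size -/
def Wt (s n : ℕ) : ℕ := if n = s then 3 else if n = 2 ∨ (s / 2 ≤ n ∧ n ≠ s - 2) then 2 else 1

theorem Wt_pos (s n : ℕ) : 1 ≤ Wt s n := by unfold Wt; split_ifs <;> omega
theorem Wt_le (s n : ℕ) : Wt s n ≤ 3 := by unfold Wt; split_ifs <;> omega
theorem Wt_three {s n : ℕ} : Wt s n = 3 ↔ n = s := by unfold Wt; split_ifs <;> omega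
theorem Wt_two {s n : ℕ} : Wt s n = 2 ↔ n ≠ s ∧ (n = 2 ∨ (s / 2 ≤ n ∧ n ≠ s - 2)) := by
  unfold Wt; split_ifs <;> omega

theorem group_ge {α : Type} [DecidableEq α] (A : Finset α) (F : α → ℕ) (s : ℕ) (hs : 24 < s)
    (hsum : ∑ x ∈ A, F x = s) : 3 ≤ ∑ x ∈ A, Wt s (F x) := by
  rcases Nat.lt_or_ge A.card 3 with h | h
  · have : A.card = 0 ∨ A.card = 1 ∨ A.card = 2 := by omega
    rcases this with h | h | h
    · rw [Finset.card_eq_zero] at h; subst h; simp at hsum; omega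
    · obtain ⟨x, rfl⟩ := Finset.card_eq_one.1 h
      simp only [Finset.sum_singleton] at *
      rw [Wt_three.2 hsum]
    · obtain ⟨x, y, hxy, rfl⟩ := Finset.card_eq_two.1 h
      rw [Finset.sum_pair hxy] at *
      unfold Wt; split_ifs <;> omega
  · have : ∑ x ∈ A, 1 ≤ ∑ x ∈ A, Wt s (F x) := Finset.sum_le_sum fun x _ => Wt_pos _ _
    simp at this; omega

theorem group_eq {α : Type} [DecidableEq α] (A : Finset α) (F : α → ℕ) (s : ℕ)
    (hsum : ∑ x ∈ A, F x = s) (hW : ∑ x ∈ A, Wt s (F x) = 3) (x : α) (hx : x ∈ A)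
    (hx2 : Wt s (F x) = 2) : ∃ y ∈ A, Wt s (F y) = 1 ∧ F x + F y = s := by
  rw [← Finset.add_sum_erase _ _ hx] at hsum hW
  have h1 : ∑ x ∈ A.erase x, 1 ≤ ∑ x ∈ A.erase x, Wt s (F x) :=
    Finset.sum_le_sum fun x _ => Wt_pos _ _
  have hne : A.erase x ≠ ∅ := by
    intro h; rw [h] at hW; simp at hW; omega
  have hc : (A.erase x).card = 1 := by
    have := Finset.card_pos.2 (Finset.nonempty_iff_ne_empty.2 hne)
    simp only [Finset.sum_const, smul_eq_mul, mul_one] at h1; omega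
  obtain ⟨y, hy⟩ := Finset.card_eq_one.1 hc
  rw [hy] at hsum hW
  simp only [Finset.sum_singleton] at *
  refine ⟨y, ?_, by omega, hsum⟩
  have : y ∈ A.erase x := by rw [hy]; simp
  exact Finset.mem_of_mem_erase this

section loc
set_option linter.unusedSectionVars false
variable {α : Type} [DecidableEq α] (X : Finset α) (val : α → List Bool) (F sz : α → ℕ)
  (s a k : ℕ)

/-- local data of one tree `T_i` -/
structure Loc : Prop where
  hk : 1 ≤ k
  hs4 : 4 ∣ s
  hs : 24 * k < s
  ha : s / 4 + 6 * k ≤ a ∧ a ≤ s / 2 - 18 * k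
  inj : Function.Injective val
  hsz : ∀ x ∈ X, val x ≠ [] → (val x = [false] ∧ sz x = a) ∨ (val x = [true] ∧ sz x = s - 2) ∨
    sz x = s / 2 - 1 ∨ sz x = s / 2 - 2 ∨ sz x ≤ s / 4 - 1
  hroot : ∀ x ∈ X, val x = [] → sz x = s - 1 + a
  h1 : ∀ x ∈ X, F x ≤ sz x
  h2 : ∀ x ∈ X, sz x ≤ ∑ y ∈ X with val x <+: val y, F y
  h3 : (∀ x ∈ X, val x ≠ []) → s + a ≤ s + ∑ x ∈ X, F x
  h4 : ∑ x ∈ X, F x ≤ s - 1 + a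
  h5 : ∀ x ∈ X, F x ≤ s

variable {X val F sz s a k}

theorem Loc.h2r (H : Loc X val F sz s a k) (x : α) (hx : x ∈ X) (hv : val x = []) :
    s - 1 + a ≤ ∑ y ∈ X, F y := by
  rw [← H.hroot x hx hv]
  exact (H.h2 x hx).trans (Finset.sum_le_sum_of_subset (Finset.filter_subset _ _))

theorem Loc.h3' (H : Loc X val F sz s a k) : a ≤ ∑ x ∈ X, F x + 1 := by
  by_cases h : ∀ x ∈ X, val x ≠ []
  · have := H.h3 h; omega
  · push Not at h
    obtain ⟨x, hx, hv⟩ := h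
    have := H.h2r x hx hv
    omega

theorem Loc.ne (H : Loc X val F sz s a k) : X ≠ ∅ := by
  intro h
  have := H.h3 (by simp [h])
  have h1 := H.ha
  have h2 := H.hk
  rw [h, Finset.sum_empty] at this
  omega

theorem Loc.one (H : Loc X val F sz s a k) (x : α) (hX : X = {x}) :
    val x ≠ [] ∧ F x = sz x ∧ a ≤ F x ∧ Wt s (F x) = 1 := by
  have hx : x ∈ X := by simp [hX]
  have e1 := H.h1 x hx
  have e2 : sz x ≤ F x := by
    refine (H.h2 x hx).trans ((Finset.sum_le_sum_of_subset (Finset.filter_subset _ _)).trans ?_)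
    simp [hX]
  have e5 := H.h5 x hx
  have ha := H.ha
  have hs := H.hs
  have hk := H.hk
  have hs4 := H.hs4
  have hv : val x ≠ [] := by
    intro hv
    have := H.hroot x hx hv
    omega
  have e3 := H.h3 (by intro y hy; rw [hX, Finset.mem_singleton] at hy; rw [hy]; exact hv)
  rw [hX, Finset.sum_singleton] at e3
  have := H.hsz x hx hv
  refine ⟨hv, by omega, by omega, ?_⟩
  unfold Wt; split_ifs <;> omega

/-- a component of size `s` contains the root -/
theorem Loc.big (H : Loc X val F sz s a k) (x : α) (hx : x ∈ X) (h : F x = s) : val x = [] := by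
  by_contra hv
  have := H.hsz x hx hv
  have := H.h1 x hx
  have ha := H.ha
  have hs := H.hs
  have hk := H.hk
  omega

/-- if `x` is the root and `X = {x, y}`, the fibre of `y` is the subtree of `y` -/
theorem Loc.two_sub (H : Loc X val F sz s a k) (x y : α) (hxy : x ≠ y) (hX : X = {x, y})
    (hv : val x = []) : F y = sz y := by
  have hy : y ∈ X := by simp [hX]
  have e1 := H.h1 y hy
  have hyv : val y ≠ [] := fun h => hxy (H.inj (hv.trans h.symm))
  have e2 := H.h2 y hy
  have : X.filter (fun z => val y <+: val z) ⊆ {y} := by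
    intro z hz
    rw [Finset.mem_filter, hX] at hz
    simp only [Finset.mem_insert, Finset.mem_singleton] at hz ⊢
    rcases hz with ⟨rfl | rfl, h⟩
    · rw [hv] at h
      exact absurd (List.prefix_nil.1 h) hyv
    · rfl
  have := Finset.sum_le_sum_of_subset (f := F) this
  rw [Finset.sum_singleton] at this
  omega

theorem Loc.two_no_s (H : Loc X val F sz s a k) (x y : α) (hxy : x ≠ y) (hX : X = {x, y}) :
    F x ≠ s := by
  intro h
  have hx : x ∈ X := by simp [hX]
  have hy : y ∈ X := by simp [hX]
  have hv := H.big x hx h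
  have e := H.two_sub x y hxy hX hv
  have hyv : val y ≠ [] := fun h => hxy (H.inj (hv.trans h.symm))
  have e1 := H.h2r x hx hv
  have e2 := H.h4
  rw [hX, Finset.sum_pair hxy] at e1 e2
  have ha := H.ha
  have hs := H.hs
  have hk := H.hk
  have hs4 := H.hs4
  have := H.hsz y hy hyv
  rcases this with ⟨_, h⟩ | ⟨_, h⟩ | h | h | h <;> omega

theorem Loc.two_le (H : Loc X val F sz s a k) (h : X.card = 2) : ∀ x ∈ X, Wt s (F x) ≤ 2 := by
  obtain ⟨x, y, hxy, hX⟩ := Finset.card_eq_two.1 h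
  have a1 := H.two_no_s x y hxy hX
  have a2 := H.two_no_s y x hxy.symm (by rw [hX, Finset.pair_comm])
  intro z hz
  have := Wt_le s (F z)
  have : Wt s (F z) ≠ 3 := by
    rw [Ne, Wt_three]
    rw [hX] at hz
    simp only [Finset.mem_insert, Finset.mem_singleton] at hz
    rcases hz with rfl | rfl <;> assumption
  omega

theorem Loc.two_aux (H : Loc X val F sz s a k) (x y : α) (hxy : x ≠ y) (hX : X = {x, y})
    (hx3 : F x ≤ 3 * s / 4 - 6 * k) (hy3 : F y ≤ 3 * s / 4 - 6 * k)
    (hx : s / 2 ≤ F x) (hy : F y = 2 ∨ s / 2 ≤ F y) : False := by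
  have hxX : x ∈ X := by simp [hX]
  have hyX : y ∈ X := by simp [hX]
  have ha := H.ha
  have hs := H.hs
  have hk := H.hk
  have hs4 := H.hs4
  have x1 := H.h1 x hxX
  have y1 := H.h1 y hyX
  by_cases hv : val x = []
  · have e := H.h2r x hxX hv
    rw [hX, Finset.sum_pair hxy] at e
    have e2 := H.two_sub x y hxy hX hv
    have hyv : val y ≠ [] := fun h => hxy (H.inj (hv.trans h.symm))
    have := H.hsz y hyX hyv
    omega
  · have hz := H.hsz x hxX hv
    have e2 := (H.h2 x hxX).trans (Finset.sum_le_sum_of_subset (Finset.filter_subset _ _))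
    rw [hX, Finset.sum_pair hxy] at e2
    by_cases hyv : val y = []
    · have e2 := H.two_sub y x hxy.symm (by rw [hX, Finset.pair_comm]) hyv
      omega
    · have hz' := H.hsz y hyX hyv
      have : val x = [true] := by
        rcases hz with hz | hz | hz
        · omega
        · exact hz.1
        · omega
      have : val y = [true] := by
        rcases hz' with hz | hz | hz
        · omega
        · exact hz.1
        · omega
      exact hxy (H.inj (by simp [*]))

theorem Loc.two (H : Loc X val F sz s a k) (h : X.card = 2) (hW : ∀ x ∈ X, Wt s (F x) = 2)
    (h3 : ∀ x ∈ X, s / 2 ≤ F x → F x ≤ 3 * s / 4 - 6 * k) : False := by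
  obtain ⟨x, y, hxy, hX⟩ := Finset.card_eq_two.1 h
  have hxX : x ∈ X := by simp [hX]
  have hyX : y ∈ X := by simp [hX]
  have wx := Wt_two.1 (hW x hxX)
  have wy := Wt_two.1 (hW y hyX)
  have tx := h3 x hxX
  have ty := h3 y hyX
  have ha := H.ha
  have hs := H.hs
  have hk := H.hk
  have hs4 := H.hs4
  have e := H.h3'
  rw [hX, Finset.sum_pair hxy] at e
  by_cases hx : s / 2 ≤ F x
  · exact H.two_aux x y hxy hX (by omega) (by omega) hx (by omega)
  · by_cases hy : s / 2 ≤ F y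
    · exact H.two_aux y x hxy.symm (by rw [hX, Finset.pair_comm]) (by omega) (by omega) hy
        (by omega)
    · omega

theorem Loc.three (H : Loc X val F sz s a k) (h : 3 ≤ X.card) :
    ∑ x ∈ X, Wt s (F x) + 3 ≤ 3 * X.card := by
  by_cases hb : ∃ x ∈ X, F x = s
  · obtain ⟨x, hx, hxs⟩ := hb
    have hv := H.big x hx hxs
    have e1 := H.h2r x hx hv
    have e2 := H.h4
    rw [← Finset.add_sum_erase _ _ hx] at e1 e2 ⊢
    have hc := Finset.card_erase_of_mem hx
    have ha := H.ha
    have hs := H.hs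
    have hk := H.hk
    have hlt : ∀ y ∈ X.erase x, F y < s / 2 := by
      intro y hy
      have := Finset.single_le_sum (f := F) (fun _ _ => Nat.zero_le _) hy
      omega
    have w2 : ∀ y ∈ X.erase x, Wt s (F y) ≤ 2 := by
      intro y hy
      have := hlt y hy
      have h3 := Wt_le s (F y)
      have : Wt s (F y) ≠ 3 := by rw [Ne, Wt_three]; omega
      omega
    rw [Wt_three.2 hxs]
    have hle := Finset.sum_le_sum w2
    simp only [Finset.sum_const, smul_eq_mul] at hle
    rcases Nat.lt_or_ge 3 X.card with h4 | h4
    · omega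
    · have hc2 : (X.erase x).card = 2 := by omega
      obtain ⟨y, z, hyz, hX⟩ := Finset.card_eq_two.1 hc2
      have hy := hlt y (by simp [hX])
      have hz := hlt z (by simp [hX])
      have wy := w2 y (by simp [hX])
      have wz := w2 z (by simp [hX])
      rw [hX, Finset.sum_pair hyz] at e1 e2 ⊢
      by_contra hcon
      have wy' := Wt_two.1 (show Wt s (F y) = 2 by omega)
      have wz' := Wt_two.1 (show Wt s (F z) = 2 by omega)
      omega
  · push Not at hb
    have w2 : ∀ y ∈ X, Wt s (F y) ≤ 2 := by
      intro y hy
      have h3 := Wt_le s (F y)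
      have : Wt s (F y) ≠ 3 := by rw [Ne, Wt_three]; exact hb y hy
      omega
    have hle := Finset.sum_le_sum w2
    simp only [Finset.sum_const, smul_eq_mul] at hle
    omega

theorem Loc.main (H : Loc X val F sz s a k) : 1 ≤ X.card ∧
    ∑ x ∈ X, Wt s (F x) + 2 ≤ 3 * X.card ∧
    (∑ x ∈ X, Wt s (F x) + 2 = 3 * X.card →
      X.card = 1 ∨ (X.card = 2 ∧ ∀ x ∈ X, Wt s (F x) = 2)) := by
  have h0 : 1 ≤ X.card := Finset.card_pos.2 (Finset.nonempty_iff_ne_empty.2 H.ne)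
  refine ⟨h0, ?_⟩
  rcases Nat.lt_or_ge X.card 3 with h | h
  · have : X.card = 1 ∨ X.card = 2 := by omega
    rcases this with h | h
    · obtain ⟨x, hX⟩ := Finset.card_eq_one.1 h
      have := (H.one x hX).2.2.2
      refine ⟨?_, fun _ => Or.inl h⟩
      rw [hX, Finset.sum_singleton, this]; simp
    · have h2 := H.two_le h
      have hle := Finset.sum_le_sum h2
      simp only [Finset.sum_const, smul_eq_mul] at hle
      refine ⟨by omega, fun he => Or.inr ⟨h, ?_⟩⟩
      have : ∑ x ∈ X, Wt s (F x) = ∑ x ∈ X, 2 := by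
        simp only [Finset.sum_const, smul_eq_mul]; omega
      exact (Finset.sum_eq_sum_iff_of_le h2).1 this
  · have := H.three h
    exact ⟨by omega, by omega⟩

end loc
end TP

namespace TP
section conc
variable {k : ℕ} (hk : 0 < 3 * k) (T : Fin (3*k) → RBT)

def par : Vtx k T → Vtx k T
  | Sum.inl i => Sum.inl ⟨i - 1, by omega⟩
  | Sum.inr ⟨i, x⟩ => if x.1 = [] then Sum.inl i else
      Sum.inr ⟨i, ⟨x.1.dropLast, (T i).valid_prefix (List.dropLast_prefix _) x.2⟩⟩

def dep : Vtx k T → ℕ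
  | Sum.inl i => i
  | Sum.inr ⟨i, x⟩ => i + 1 + x.1.length

def rt : Vtx k T := Sum.inl ⟨0, hk⟩

theorem par_dep (v : Vtx k T) (hv : v ≠ rt hk T) : dep T (par T v) < dep T v := by
  rcases v with i | ⟨i, x, hx⟩
  · have : (i : ℕ) ≠ 0 := by
      intro h; apply hv; simp only [rt]; congr 1; exact Fin.ext h
    simp only [par, dep]; omega
  · simp only [par]
    split_ifs with h
    · simp only [dep]; omega
    · simp only [dep, List.length_dropLast]
      have := List.length_pos_iff.2 h
      omega

theorem T_adj (v w : Vtx k T) : (TGraph k T).Adj v w ↔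
    (v ≠ rt hk T ∧ w = par T v) ∨ (w ≠ rt hk T ∧ v = par T w) := by
  have key : ∀ v w : Vtx k T, (v ≠ w ∧ (match v, w with
    | Sum.inl i, Sum.inl j => (i : ℕ) + 1 = (j : ℕ)
    | Sum.inl i, Sum.inr ⟨j, x⟩ => i = j ∧ x.1 = []
    | Sum.inr ⟨i, x⟩, Sum.inr ⟨j, y⟩ => i = j ∧ ∃ c : Bool, y.1 = x.1 ++ [c]
    | _, _ => False)) ↔ (w ≠ rt hk T ∧ v = par T w) := by
    intro v w
    rcases v with i | ⟨i, x, hx⟩ <;> rcases w with j | ⟨j, y, hy⟩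
    · simp only [rt, par, ne_eq, Sum.inl.injEq, Fin.ext_iff]; omega
    · simp only [rt, par, ne_eq]
      split_ifs with h <;> simp [h]
    · simp [par]
    · simp only [rt, par, ne_eq]
      split_ifs with h
      · subst h; simp
      · constructor
        · rintro ⟨_, rfl, c, hc⟩
          subst hc
          simp
        · rintro ⟨_, h1⟩
          simp only [Sum.inr.injEq, Sigma.mk.injEq] at h1
          obtain ⟨rfl, h1⟩ := h1
          simp only [heq_eq_eq, Subtype.mk.injEq] at h1
          subst h1
          refine ⟨?_, rfl, y.getLast h, (List.dropLast_append_getLast h).symm⟩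
          intro h2
          simp only [Sum.inr.injEq, Sigma.mk.injEq, heq_eq_eq, Subtype.mk.injEq, true_and] at h2
          have := congrArg List.length h2
          have h3 := List.length_pos_iff.2 h
          simp at this; omega
  rw [TGraph, SimpleGraph.fromRel_adj, ← key, ← key]
  constructor
  · rintro ⟨h, h1 | h1⟩
    · exact Or.inr ⟨h, h1⟩
    · exact Or.inl ⟨h.symm, h1⟩
  · rintro (⟨h, h1⟩ | ⟨h, h1⟩)
    · exact ⟨h.symm, Or.inr h1⟩
    · exact ⟨h, Or.inl h1⟩

variable {T} (X : Set (Vtx k T)) (top : Vtx k T → Vtx k T)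
  (t1 : ∀ v, v = rt hk T ∨ v ∈ X → top v = v)
  (t2 : ∀ v, ¬ (v = rt hk T ∨ v ∈ X) → top v = top (par T v))

include t1 t2 in
theorem top_inr (i : Fin (3*k)) (l : List Bool) (h : (T i).Valid l) :
    (∃ l', ∃ h' : (T i).Valid l', Sum.inr ⟨i, l', h'⟩ ∈ X ∧ l' <+: l ∧
      top (Sum.inr ⟨i, l, h⟩) = Sum.inr ⟨i, l', h'⟩ ∧
      ∀ l'', ∀ h'' : (T i).Valid l'', Sum.inr ⟨i, l'', h''⟩ ∈ X → l'' <+: l → l'' <+: l') ∨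
    (top (Sum.inr ⟨i, l, h⟩) = top (Sum.inl i) ∧
      ∀ l'', ∀ h'' : (T i).Valid l'', l'' <+: l → Sum.inr ⟨i, l'', h''⟩ ∉ X) := by
  induction l using List.reverseRecOn with
  | nil =>
    by_cases hx : Sum.inr ⟨i, [], h⟩ ∈ X
    · left
      exact ⟨[], h, hx, List.prefix_rfl, t1 _ (Or.inr hx), fun _ _ _ h => h⟩
    · right
      refine ⟨?_, ?_⟩
      · rw [t2 _ (by rintro (h1 | h1); exacts [by simp [rt] at h1, hx h1])]
        simp [par]
      · intro l'' h'' hp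
        have := List.prefix_nil.1 hp
        subst this; exact hx
  | append_singleton l c ih =>
    by_cases hx : Sum.inr ⟨i, l ++ [c], h⟩ ∈ X
    · left
      exact ⟨_, h, hx, List.prefix_rfl, t1 _ (Or.inr hx), fun _ _ _ h => h⟩
    · have hl : (T i).Valid l := (T i).valid_prefix (List.prefix_append _ _) h
      have e : top (Sum.inr ⟨i, l ++ [c], h⟩) = top (Sum.inr ⟨i, l, hl⟩) := by
        rw [t2 _ (by rintro (h1 | h1); exacts [by simp [rt] at h1, hx h1])]
        simp [par]
      have pp : ∀ l'', ∀ h'' : (T i).Valid l'', Sum.inr ⟨i, l'', h''⟩ ∈ X →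
          l'' <+: l ++ [c] → l'' <+: l := by
        intro l'' h'' hX hp
        rcases List.prefix_concat_iff.1 hp with h1 | h1
        · subst h1; exact absurd hX hx
        · exact h1
      rw [e]
      rcases ih hl with ⟨l', h', a1, a2, a3, a4⟩ | ⟨a1, a2⟩
      · left
        exact ⟨l', h', a1, a2.trans (List.prefix_append _ _), a3,
          fun l'' h'' b1 b2 => a4 l'' h'' b1 (pp l'' h'' b1 b2)⟩
      · right
        exact ⟨a1, fun l'' h'' b1 b2 => a2 l'' h'' (pp l'' h'' b2 b1) b2⟩

include t1 t2 in
theorem top_inl (i : Fin (3*k)) : ∃ j, top (Sum.inl i) = Sum.inl j ∧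
    (Sum.inl j = rt hk T ∨ Sum.inl j ∈ X) := by
  obtain ⟨n, hn⟩ := i
  induction n with
  | zero => exact ⟨_, t1 _ (Or.inl rfl), Or.inl rfl⟩
  | succ n ih =>
    by_cases h : (Sum.inl ⟨n + 1, hn⟩ = rt hk T ∨ Sum.inl ⟨n + 1, hn⟩ ∈ X)
    · exact ⟨_, t1 _ h, h⟩
    · rw [t2 _ h]
      simpa [par] using ih (by omega)

end conc
end TP

namespace TP
section fin
set_option linter.unusedSimpArgs false
open Classical

/-- the fibre over `x` -/
noncomputable def fib {V : Type} [Fintype V] (top : V → V) (x : V) : Finset V :=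
  Finset.univ.filter (fun v => top v = x)

theorem mem_fib {V : Type} [Fintype V] {top : V → V} {x v : V} : v ∈ fib top x ↔ top v = x := by
  simp [fib]

/-- number of vertices in the fibre over `x` -/
noncomputable def fc {V : Type} [Fintype V] (top : V → V) (x : V) : ℕ :=
  (fib top x).card

theorem group_sum {V ι : Type} [Fintype V] (top : V → V) (X' : Finset V) (lam : V → ι)
    (h1 : ∀ v, top v ∈ X') (h2 : ∀ v, lam (top v) = lam v) (g : ι) :
    ∑ x ∈ X' with lam x = g, fc top x = (Finset.univ.filter (fun v => lam v = g)).card := by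
  rw [Finset.card_eq_sum_card_fiberwise (f := top) (t := X'.filter (fun x => lam x = g))]
  · refine Finset.sum_congr rfl ?_
    intro x hx
    rw [fc]
    congr 1
    ext v
    simp only [Finset.mem_filter, mem_fib, Finset.mem_univ, true_and]
    constructor
    · intro h; refine ⟨?_, h⟩
      rw [← h2, h]; exact (Finset.mem_filter.1 hx).2
    · exact fun h => h.2
  · intro v hv
    simp only [Finset.coe_filter, Finset.mem_univ, true_and, Set.mem_ofPred_eq] at hv ⊢
    exact ⟨h1 v, (h2 v).trans hv⟩

theorem sum_split {k : ℕ} {T : Fin (3*k) → RBT} (p : Vtx k T → Prop) (φ : Vtx k T → ℕ) :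
    ∑ v with p v, φ v = ∑ j with p (Sum.inl j), φ (Sum.inl j) +
      ∑ i, ∑ x with p (Sum.inr ⟨i, x⟩), φ (Sum.inr ⟨i, x⟩) := by
  simp only [Finset.sum_filter]
  rw [Fintype.sum_sum_type, Fintype.sum_sigma]

variable {k : ℕ} (hk : 0 < 3 * k) {T : Fin (3*k) → RBT} (X : Set (Vtx k T))
  (top : Vtx k T → Vtx k T)
  (t1 : ∀ v, v = rt hk T ∨ v ∈ X → top v = v)
  (t2 : ∀ v, ¬ (v = rt hk T ∨ v ∈ X) → top v = top (par T v))

/-- vertices of `T_i` -/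
noncomputable def Ui (T : Fin (3*k) → RBT) (i : Fin (3*k)) (p : {l // (T i).Valid l} → Prop) :
    Finset (Vtx k T) :=
  (Finset.univ.filter p).image (fun x => Sum.inr ⟨i, x⟩)

theorem card_Ui (i : Fin (3*k)) (p : {l // (T i).Valid l} → Prop) :
    (Ui T i p).card = (Finset.univ.filter p).card := by
  rw [Ui, Finset.card_image_of_injective]
  intro x y h
  simpa using h

theorem card_Ui_ext (i : Fin (3*k)) (l : List Bool) :
    (Ui T i (fun m => l <+: m.1)).card = ((T i).sub l).size := by
  rw [card_Ui, ← RBT.card_ext]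
  congr

theorem mem_Ui (i : Fin (3*k)) (p : {l // (T i).Valid l} → Prop) (v : Vtx k T) :
    v ∈ Ui T i p ↔ ∃ x, p x ∧ v = Sum.inr ⟨i, x⟩ := by
  simp only [Ui, Finset.mem_image, Finset.mem_filter, mem_fib, Finset.mem_univ, true_and]
  constructor
  · rintro ⟨x, h, rfl⟩; exact ⟨x, h, rfl⟩
  · rintro ⟨x, h, rfl⟩; exact ⟨x, h, rfl⟩

include t1 t2 in
theorem fib_sub (i : Fin (3*k)) (x : {l // (T i).Valid l}) (v : Vtx k T)
    (h : top v = Sum.inr ⟨i, x⟩) : v ∈ Ui T i (fun m => x.1 <+: m.1) := by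
  rw [mem_Ui]
  rcases v with j | ⟨j, m, hm⟩
  · obtain ⟨j', h1, _⟩ := top_inl hk X top t1 t2 j
    rw [h1] at h; simp at h
  · rcases top_inr hk X top t1 t2 j m hm with ⟨l', h', a1, a2, a3, a4⟩ | ⟨a1, a2⟩
    · rw [a3] at h
      simp only [Sum.inr.injEq, Sigma.mk.injEq] at h
      obtain ⟨rfl, h⟩ := h
      simp only [heq_eq_eq] at h
      subst h
      exact ⟨⟨m, hm⟩, a2, rfl⟩
    · obtain ⟨j', h1, _⟩ := top_inl hk X top t1 t2 j
      rw [a1, h1] at h; simp at h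

include t1 t2 in
theorem mkLoc (s a : ℕ) (L R : RBT) (i : Fin (3*k)) (hT : T i = RBT.node L R)
    (hk1 : 1 ≤ k) (hs4 : 4 ∣ s) (hs : 24 * k < s)
    (ha : s / 4 + 6 * k ≤ a ∧ a ≤ s / 2 - 18 * k)
    (hL : L.IsNice ∧ L.size = a) (hR : R.IsNice ∧ R.size = s - 2) (hle : ∀ v, fc top v ≤ s) :
    Loc (Finset.univ.filter (fun x : {l // (T i).Valid l} => Sum.inr ⟨i, x⟩ ∈ X))
      Subtype.val (fun x => fc top (Sum.inr ⟨i, x⟩)) (fun x => ((T i).sub x.1).size) s a k where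
  hk := hk1
  hs4 := hs4
  hs := hs
  ha := ha
  inj := Subtype.val_injective
  hsz := by
    intro x _ hx
    have := RBT.sizes L R s a k hk1 hs4 hs ha hL hR x.1 hx
    simpa only [← hT] using this
  hroot := by
    intro x _ hx
    simp only [hx, RBT.sub, hT, RBT.size]
    omega
  h1 := by
    intro x hx
    rw [← card_Ui_ext]
    refine Finset.card_le_card ?_
    intro v hv
    exact fib_sub hk X top t1 t2 i x v (mem_fib.1 hv)
  h2 := by
    intro x hx
    rw [← card_Ui_ext]
    refine (Finset.card_le_card ?_).trans (Finset.card_biUnion_le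
      (t := fun y => fib top (Sum.inr ⟨i, y⟩)))
    intro v hv
    obtain ⟨⟨m, hm⟩, h1, rfl⟩ := (mem_Ui _ _ _).1 hv
    have hx' := (Finset.mem_filter.1 hx).2
    simp only [Finset.mem_biUnion, Finset.mem_filter, mem_fib, Finset.mem_univ, true_and]
    rcases top_inr hk X top t1 t2 i m hm with ⟨l', h', a1, a2, a3, a4⟩ | ⟨a1, a2⟩
    · exact ⟨⟨l', h'⟩, ⟨a1, a4 x.1 x.2 hx' h1⟩, a3⟩
    · exact absurd hx' (a2 x.1 x.2 h1)
  h3 := by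
    intro _
    have hU : (insert (Sum.inl i) (Ui T i (fun _ => True))).card = s + a := by
      rw [Finset.card_insert_of_notMem (by simp [mem_Ui]), card_Ui, Finset.filter_true,
        Finset.card_univ, RBT.card_valid, hT, RBT.size]
      omega
    rw [← hU]
    have hsub : insert (Sum.inl i) (Ui T i (fun _ => True)) ⊆
        (fib top (top (Sum.inl i))) ∪
        (Finset.univ.filter (fun x : {l // (T i).Valid l} => Sum.inr ⟨i, x⟩ ∈ X)).biUnion
          (fun y => fib top (Sum.inr ⟨i, y⟩)) := by
      intro v hv
      simp only [Finset.mem_union, Finset.mem_biUnion, Finset.mem_filter, mem_fib, Finset.mem_univ,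
        true_and]
      rcases Finset.mem_insert.1 hv with rfl | hv
      · exact Or.inl rfl
      · obtain ⟨⟨m, hm⟩, h1, rfl⟩ := (mem_Ui _ _ _).1 hv
        rcases top_inr hk X top t1 t2 i m hm with ⟨l', h', a1, a2, a3, a4⟩ | ⟨a1, a2⟩
        · exact Or.inr ⟨⟨l', h'⟩, a1, a3⟩
        · exact Or.inl a1
    refine (Finset.card_le_card hsub).trans ((Finset.card_union_le _ _).trans ?_)
    exact Nat.add_le_add (hle (top (Sum.inl i))) Finset.card_biUnion_le
  h4 := by
    have hU : (Ui T i (fun _ => True)).card = s - 1 + a := by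
      rw [card_Ui, Finset.filter_true,
        Finset.card_univ, RBT.card_valid, hT, RBT.size]
      omega
    rw [← hU]
    simp only [fc]
    rw [← Finset.card_biUnion]
    · refine Finset.card_le_card ?_
      intro v hv
      simp only [Finset.mem_biUnion, Finset.mem_filter, mem_fib, Finset.mem_univ, true_and] at hv
      obtain ⟨x, _, hx⟩ := hv
      have := fib_sub hk X top t1 t2 i x v hx
      rw [mem_Ui] at this ⊢
      obtain ⟨y, _, hy⟩ := this
      exact ⟨y, trivial, hy⟩
    · intro x _ y _ hxy
      rw [Function.onFun, Finset.disjoint_left]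
      intro v hv hv'
      simp only [Finset.mem_filter, mem_fib, Finset.mem_univ, true_and] at hv hv'
      rw [hv] at hv'
      apply hxy
      simpa using hv'
  h5 := fun x _ => hle _

include t1 t2 in
/-- The upper bound on the two components when all the path edges are cut. -/
theorem upper (s a : ℕ) (L R : RBT) (i : Fin (3*k)) (hT : T i = RBT.node L R) (hs : 2 ≤ s)
    (hL : L.size = a) (hR : R.size = s - 2) (x : {l // (T i).Valid l})
    (hall : ∀ j, top (Sum.inl j) = Sum.inl j) :
    fc top (Sum.inl i) + fc top (Sum.inr ⟨i, x⟩) ≤ s + a := by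
  have hU : (insert (Sum.inl i) (Ui T i (fun _ => True))).card = s + a := by
    rw [Finset.card_insert_of_notMem (by simp [mem_Ui]), card_Ui, Finset.filter_true,
      Finset.card_univ, RBT.card_valid, hT, RBT.size]
    omega
  rw [← hU, fc, fc, ← Finset.card_union_of_disjoint]
  · refine Finset.card_le_card ?_
    intro v hv
    simp only [Finset.mem_union, Finset.mem_filter, mem_fib, Finset.mem_univ, true_and] at hv
    rw [Finset.mem_insert]
    rcases hv with hv | hv
    · rcases v with j | ⟨j, m, hm⟩
      · rw [hall] at hv; exact Or.inl hv
      · rcases top_inr hk X top t1 t2 j m hm with ⟨l', h', a1, a2, a3, a4⟩ | ⟨a1, a2⟩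
        · rw [a3] at hv; simp at hv
        · rw [a1, hall] at hv
          simp only [Sum.inl.injEq] at hv
          subst hv
          exact Or.inr ((mem_Ui _ _ _).2 ⟨_, trivial, rfl⟩)
    · have := fib_sub hk X top t1 t2 i x v hv
      rw [mem_Ui] at this
      obtain ⟨y, _, hy⟩ := this
      exact Or.inr ((mem_Ui _ _ _).2 ⟨y, trivial, hy⟩)
  · rw [Finset.disjoint_left]
    intro v hv hv'
    simp only [Finset.mem_filter, mem_fib, Finset.mem_univ, true_and] at hv hv'
    rw [hv] at hv'
    simp at hv'

end fin
end TP

namespace TP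
section final
open Classical

theorem key (k s : ℕ) (hk : 1 ≤ k) (hk3 : 0 < 3 * k) (hs4 : 4 ∣ s) (hs : 24 * k < s)
    (a : Fin (3*k) → ℕ) (ha : ∀ i, s / 4 + 6 * k ≤ a i ∧ a i ≤ s / 2 - 18 * k)
    (Lsh Rsh : Fin (3*k) → RBT)
    (hL : ∀ i, (Lsh i).IsNice ∧ (Lsh i).size = a i)
    (hR : ∀ i, (Rsh i).IsNice ∧ (Rsh i).size = s - 2)
    (T : Fin (3*k) → RBT) (hT : ∀ i, T i = RBT.node (Lsh i) (Rsh i))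
    (X : Set (Vtx k T)) (lam : Vtx k T → Fin (4*k))
    (top : Vtx k T → Vtx k T)
    (t1 : ∀ v, v = rt hk3 _ ∨ v ∈ X → top v = v)
    (t2 : ∀ v, ¬ (v = rt hk3 _ ∨ v ∈ X) → top v = top (par _ v))
    (hrt : rt hk3 _ ∉ X) (hX : X.ncard = 6 * k - 1)
    (hlam : ∀ v, lam (top v) = lam v)
    (hg : ∀ g, {v | lam v = g}.ncard = s) :
    (∀ j, top (Sum.inl j) = Sum.inl j) ∧
    ∀ i, fc top (Sum.inl i) = s ∧ ∃ h : (T i).Valid [false],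
      ∀ x, Sum.inr ⟨i, x⟩ ∈ X ↔ x = ⟨[false], h⟩ := by
  obtain ⟨p, hp⟩ : ∃ p : Vtx k T → Prop, ∀ v, p v ↔ (v = rt hk3 _ ∨ v ∈ X) :=
    ⟨_, fun _ => Iff.rfl⟩
  have hpr : ∀ i (x : {l // (T i).Valid l}), p (Sum.inr ⟨i, x⟩) ↔ Sum.inr ⟨i, x⟩ ∈ X := by
    intro i x; simp [hp, rt]
  have htp : ∀ v, p (top v) := by
    intro v
    rcases v with j | ⟨j, m, hm⟩
    · obtain ⟨j', h1, h2⟩ := top_inl hk3 X top t1 t2 j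
      rw [h1]; exact (hp _).2 h2
    · rcases top_inr hk3 X top t1 t2 j m hm with ⟨l', h', a1, a2, a3, a4⟩ | ⟨a1, a2⟩
      · rw [a3]; exact (hp _).2 (Or.inr a1)
      · obtain ⟨j', h1, h2⟩ := top_inl hk3 X top t1 t2 j
        rw [a1, h1]; exact (hp _).2 h2
  have hg' : ∀ g, (Finset.univ.filter (fun v => lam v = g)).card = s := by
    intro g
    rw [← hg g, Set.ncard_eq_toFinset_card']
    congr 1; ext v; simp
  have hle : ∀ v, fc top v ≤ s := by
    intro v
    rw [← hg' (lam v), fc]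
    refine Finset.card_le_card ?_
    intro w hw
    rw [mem_fib] at hw
    simp [← hw, hlam]
  have hgs : ∀ g, ∑ x ∈ (Finset.univ.filter p) with lam x = g, fc top x = s := by
    intro g
    rw [← hg' g]
    convert group_sum top (Finset.univ.filter p) lam (by simpa using htp) hlam g
  have hloc := fun i => mkLoc hk3 X top t1 t2 s (a i) (Lsh i) (Rsh i) i (hT i) hk hs4 hs (ha i) (hL i)
    (hR i) hle
  have hmain := fun i => (hloc i).main
  -- counting
  have hcard : (Finset.univ.filter p).card = 6 * k := by
    have : Finset.univ.filter p = insert (rt hk3 T) X.toFinset := by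
      ext v; simp [hp]
    rw [this, Finset.card_insert_of_notMem (by simpa using hrt), ← Set.ncard_eq_toFinset_card',
      hX]
    omega
  have hc := sum_split p (fun _ => 1)
  have hw := sum_split p (fun v => Wt s (fc top v))
  have hfl : ∀ i, (Finset.univ.filter (fun x : {l // (T i).Valid l} => p (Sum.inr ⟨i, x⟩))) =
      Finset.univ.filter (fun x : {l // (T i).Valid l} => Sum.inr ⟨i, x⟩ ∈ X) :=
    fun i => Finset.filter_congr (fun x _ => hpr i x)
  simp only [hfl] at hc hw
  simp only [Finset.sum_const, smul_eq_mul, mul_one, hcard] at hc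
  have hfw : ∑ v with p v, Wt s (fc top v) =
      ∑ g, ∑ x ∈ (Finset.univ.filter p) with lam x = g, Wt s (fc top x) :=
    (Finset.sum_fiberwise _ _ _).symm
  have hge : ∀ g ∈ (Finset.univ : Finset (Fin (4*k))),
      3 ≤ ∑ x ∈ (Finset.univ.filter p) with lam x = g, Wt s (fc top x) :=
    fun g _ => group_ge _ _ s (by omega) (hgs g)
  have hge' := Finset.sum_le_sum hge
  rw [← hfw] at hge'
  have hseg : ∀ j ∈ (Finset.univ.filter (fun j => p (Sum.inl j))),
    Wt s (fc top (Sum.inl j)) ≤ 3 := fun j _ => Wt_le _ _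
  have hseg' := Finset.sum_le_sum hseg
  have hin : ∀ i ∈ (Finset.univ : Finset (Fin (3*k))),
      ∑ x with Sum.inr ⟨i, x⟩ ∈ X, Wt s (fc top (Sum.inr ⟨i, x⟩)) + 2 ≤
      3 * (Finset.univ.filter (fun x : {l // (T i).Valid l} => Sum.inr ⟨i, x⟩ ∈ X)).card :=
    fun i _ => (hmain i).2.1
  have hin' := Finset.sum_le_sum hin
  rw [Finset.sum_add_distrib, ← Finset.mul_sum] at hin'
  simp only [Finset.sum_const, smul_eq_mul, Finset.card_univ, Fintype.card_fin] at hge' hseg' hin'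
  -- equalities
  have e1 := (Finset.sum_eq_sum_iff_of_le hge).1 (by
    rw [← hfw]
    simp only [Finset.sum_const, smul_eq_mul, Finset.card_univ, Fintype.card_fin]; omega)
  have e2 := (Finset.sum_eq_sum_iff_of_le hseg).1 (by
    simp only [Finset.sum_const, smul_eq_mul]; omega)
  have e3 := (Finset.sum_eq_sum_iff_of_le hin).1 (by
    rw [Finset.sum_add_distrib, ← Finset.mul_sum]
    simp only [Finset.sum_const, smul_eq_mul, Finset.card_univ, Fintype.card_fin]; omega)
  have hcase := fun i => (hmain i).2.2 (e3 i (Finset.mem_univ _))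
  -- components of weight one
  have hone : ∀ v, p v → Wt s (fc top v) = 1 → s / 4 + 6 * k ≤ fc top v := by
    intro v hv hv1
    rcases v with j | ⟨i, x⟩
    · have := e2 j (by simpa using hv); omega
    · have hx := (hpr i x).1 hv
      rcases hcase i with h | ⟨h, h'⟩
      · obtain ⟨y, hy⟩ := Finset.card_eq_one.1 h
        have hxy : x = y := by
          rw [← Finset.mem_singleton, ← hy]; simpa using hx
        have := ((hloc i).one y hy).2.2.1
        have h2 := (ha i).1
        rw [hxy]; exact h2.trans this
      · have := h' x (by simpa using hx)
        omega
  have hcard1 : ∀ i,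
      (Finset.univ.filter (fun x : {l // (T i).Valid l} => Sum.inr ⟨i, x⟩ ∈ X)).card = 1 := by
    intro i
    rcases hcase i with h | ⟨h, h'⟩
    · exact h
    · exfalso
      refine (hloc i).two h h' ?_
      intro x hx _
      have hxX := (Finset.mem_filter.1 hx).2
      obtain ⟨y, hy, hy1, hy2⟩ := group_eq _ _ s (hgs (lam (Sum.inr ⟨i, x⟩)))
        (e1 _ (Finset.mem_univ _)).symm (Sum.inr ⟨i, x⟩) (by
          simp only [Finset.mem_filter, Finset.mem_univ, true_and, and_true]
          exact (hp _).2 (Or.inr hxX)) (h' x hx)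
      have := hone y (by
        simp only [Finset.mem_filter, Finset.mem_univ, true_and] at hy
        exact hy.1) hy1
      omega
  have hall : ∀ j, p (Sum.inl j) := by
    simp only [hcard1, Finset.sum_const, smul_eq_mul, Finset.card_univ, Fintype.card_fin,
      mul_one] at hc
    have : (Finset.univ.filter (fun j => p (Sum.inl j))) = Finset.univ := by
      rw [← Finset.card_eq_iff_eq_univ, Fintype.card_fin]; omega
    intro j
    have hj : j ∈ (Finset.univ.filter (fun j => p (Sum.inl j))) := by rw [this]; simp
    simpa using hj
  have hall' : ∀ j, top (Sum.inl j) = Sum.inl j := fun j => t1 _ ((hp _).1 (hall j))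
  refine ⟨hall', fun i => ?_⟩
  have hfi : fc top (Sum.inl i) = s := Wt_three.1 (e2 i (by simpa using hall i))
  refine ⟨hfi, ?_⟩
  obtain ⟨x, hx⟩ := Finset.card_eq_one.1 (hcard1 i)
  obtain ⟨o1, o2, o3, o4⟩ := (hloc i).one x hx
  have hup := upper hk3 X top t1 t2 s (a i) (Lsh i) (Rsh i) i (hT i) (by omega) (hL i).2 (hR i).2 x
    hall'
  have hsz := (hloc i).hsz x (by rw [hx]; simp) o1
  have hai := ha i
  have hxv : x.1 = [false] := by
    rcases hsz with h | h | h | h | h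
    · exact h.1
    all_goals omega
  refine ⟨hxv ▸ x.2, fun y => ?_⟩
  have : y ∈ Finset.univ.filter (fun x : {l // (T i).Valid l} => Sum.inr ⟨i, x⟩ ∈ X) ↔ y = x := by
    rw [hx, Finset.mem_singleton]
  rw [Finset.mem_filter] at this
  simp only [Finset.mem_univ, true_and] at this
  rw [this]
  have hxe : x = ⟨[false], hxv ▸ x.2⟩ := Subtype.ext hxv
  constructor
  · intro h; exact h.trans hxe
  · intro h; exact h.trans hxe.symm

end final
end TP

/-- For every solution `P` of the instance `(T, 6k−1, 4k)` and every `i`, the subtree `L_i`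
is the only `P`-component contained in `T_i`, and the subtree of `T` induced by
`(V(T_i) \ V(L_i)) ∪ {p_i}` is a `P`-component with exactly `s` vertices. -/
theorem statement3
    (k s : ℕ) (hk : 1 ≤ k) (hs4 : 4 ∣ s) (hs : 24 * k < s)
    (a : Fin (3*k) → ℕ) (ha : ∀ i, s / 4 + 6 * k ≤ a i ∧ a i ≤ s / 2 - 18 * k)
    (Lsh Rsh : Fin (3*k) → RBT)
    (hL : ∀ i, (Lsh i).IsNice ∧ (Lsh i).size = a i)
    (hR : ∀ i, (Rsh i).IsNice ∧ (Rsh i).size = s - 2)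
    (EP : Set (Sym2 (Vtx k (nodes Lsh Rsh)))) (lam : Vtx k (nodes Lsh Rsh) → Fin (4*k))
    (hP : IsSolutionEq (TGraph k (nodes Lsh Rsh)) EP (6*k - 1) (4*k) (fun _ => s) lam)
    (i : Fin (3*k)) :
    (IsPComp (TGraph k (nodes Lsh Rsh)) EP (LiSet k (nodes Lsh Rsh) i) ∧
      ∀ C : Set (Vtx k (nodes Lsh Rsh)),
        IsPComp (TGraph k (nodes Lsh Rsh)) EP C → C ⊆ TiSet k (nodes Lsh Rsh) i →
          C = LiSet k (nodes Lsh Rsh) i) ∧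
    IsPComp (TGraph k (nodes Lsh Rsh)) EP
      ((TiSet k (nodes Lsh Rsh) i \ LiSet k (nodes Lsh Rsh) i) ∪ {Sum.inl i}) ∧
    ((TiSet k (nodes Lsh Rsh) i \ LiSet k (nodes Lsh Rsh) i) ∪ {Sum.inl i}).ncard = s := by
  have hk3 : 0 < 3 * k := by omega
  obtain ⟨hE, hEc, hlam, hg⟩ := hP
  have hadj := T_adj hk3 (nodes Lsh Rsh)
  have hdep := par_dep hk3 (nodes Lsh Rsh)
  obtain ⟨top, t1, t2, hre⟩ := abs_top _ _ _ _ hadj hdep EP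
  have hXc := abs_card _ _ _ _ hadj hdep EP hE
  have htt : ∀ v, top (top v) = top v := by
    intro v
    rcases v with j | ⟨j, m, hm⟩
    · obtain ⟨j', h1, h2⟩ := top_inl hk3 _ top t1 t2 j
      rw [h1]; exact t1 _ h2
    · rcases top_inr hk3 _ top t1 t2 j m hm with ⟨l', h', a1, a2, a3, a4⟩ | ⟨a1, a2⟩
      · rw [a3]; exact t1 _ (Or.inr a1)
      · obtain ⟨j', h1, h2⟩ := top_inl hk3 _ top t1 t2 j
        rw [a1, h1]; exact t1 _ h2
  obtain ⟨hall, hX⟩ := key k s hk hk3 hs4 hs a ha Lsh Rsh hL hR (nodes Lsh Rsh)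
    (fun _ => rfl) (cutSet (par _) (rt hk3 _) EP) lam
    top t1 t2 (fun h => h.1 rfl) (hXc.trans hEc)
    (fun v => hlam _ _ ((hre _ _).2 (htt v))) hg
  -- description of `top`
  have hd : ∀ (j : Fin (3*k)) (m : List Bool) (hm : (nodes Lsh Rsh j).Valid m),
      (m.head? = some false ∧ ∃ h, top (Sum.inr ⟨j, m, hm⟩) = Sum.inr ⟨j, [false], h⟩) ∨
      (m.head? ≠ some false ∧ top (Sum.inr ⟨j, m, hm⟩) = Sum.inl j) := by
    intro j m hm
    obtain ⟨_, hv, hXj⟩ := hX j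
    have hpre : [false] <+: m ↔ m.head? = some false := by
      rcases m with _ | ⟨c, m⟩
      · simp
      · simp only [List.cons_prefix_cons, List.nil_prefix, and_true, List.head?_cons,
          Option.some.injEq]
        exact eq_comm
    rcases top_inr hk3 _ top t1 t2 j m hm with ⟨l', h', a1, a2, a3, a4⟩ | ⟨a1, a2⟩
    · left
      have := (hXj _).1 a1
      rw [Subtype.mk.injEq] at this
      subst this
      exact ⟨hpre.1 a2, h', a3⟩
    · right
      refine ⟨fun h => a2 [false] hv (hpre.2 h) ((hXj _).2 rfl), by rw [a1, hall]⟩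
  obtain ⟨hfi, hv, hXi⟩ := hX i
  have hLtop : ∀ w, w ∈ LiSet k (nodes Lsh Rsh) i ↔ top w = Sum.inr ⟨i, [false], hv⟩ := by
    intro w
    rcases w with j | ⟨j, m, hm⟩
    · simp [LiSet, hall]
    · constructor
      · rintro ⟨⟨m', hm'⟩, h1, h2⟩
        rw [h2]
        rcases hd i m' hm' with ⟨_, _, h⟩ | ⟨h, _⟩
        · exact h
        · exact absurd h1 h
      · intro h
        rcases hd j m hm with ⟨h1, _, h2⟩ | ⟨_, h2⟩
        · rw [h2] at h
          have hji : j = i := by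
            simp only [Sum.inr.injEq, Sigma.mk.injEq] at h
            exact h.1
          subst hji
          exact ⟨⟨m, hm⟩, h1, rfl⟩
        · rw [h2] at h; simp at h
  have hRtop : ∀ w, w ∈ (TiSet k (nodes Lsh Rsh) i \ LiSet k (nodes Lsh Rsh) i) ∪ {Sum.inl i} ↔
      top w = Sum.inl i := by
    intro w
    rw [Set.mem_union, Set.mem_sdiff, hLtop, Set.mem_singleton_iff]
    rcases w with j | ⟨j, m, hm⟩
    · simp [TiSet, hall]
    · constructor
      · rintro (⟨⟨⟨m', hm'⟩, h1⟩, h2⟩ | h)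
        · rw [h1] at h2 ⊢
          rcases hd i m' hm' with ⟨_, _, h⟩ | ⟨_, h⟩
          · exact absurd h h2
          · exact h
        · simp at h
      · intro h
        left
        rw [h]
        rcases hd j m hm with ⟨_, _, h2⟩ | ⟨_, h2⟩
        · rw [h2] at h; simp at h
        · rw [h2] at h
          have hji : j = i := by simpa using h
          subst hji
          exact ⟨⟨⟨m, hm⟩, rfl⟩, by simp⟩
  have htL : top (Sum.inr ⟨i, [false], hv⟩) = Sum.inr ⟨i, [false], hv⟩ :=
    t1 _ (Or.inr ((hXi _).2 rfl))
  refine ⟨⟨⟨Sum.inr ⟨i, [false], hv⟩, ?_⟩, ?_⟩, ⟨Sum.inl i, ?_⟩, ?_⟩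
  · ext w
    rw [hLtop, Set.mem_ofPred_eq, hre, htL, eq_comm]
  · rintro C ⟨v, rfl⟩ hC
    have h1 : top v ∈ TiSet k (nodes Lsh Rsh) i := hC ((hre _ _).2 (htt v).symm)
    obtain ⟨x, hx⟩ := h1
    have h2 : top v = Sum.inr ⟨i, [false], hv⟩ := by
      rcases hd i x.1 x.2 with ⟨_, h', h⟩ | ⟨_, h⟩
      · rw [← htt, hx]; exact h
      · have h3 : top (Sum.inr ⟨i, x⟩) = Sum.inr ⟨i, x⟩ := by rw [← hx]; exact htt v
        have h4 := h.symm.trans h3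
        simp at h4
    ext w
    rw [hLtop, Set.mem_ofPred_eq, hre, h2, eq_comm]
  · ext w
    rw [hRtop, Set.mem_ofPred_eq, hre, hall, eq_comm]
  · rw [← hfi, fc, ← Set.ncard_coe_finset]
    congr 1
    ext w
    rw [hRtop, Finset.mem_coe, mem_fib]
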